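/- Let A be a split regular BiHom-Poisson superalgebra with root system Λ, and let [α] ∈ Λ/∼ be an equivalence class of connected roots. Then the subspace I_{[α]} = I_{H,[α]} ⊕ V_{[α]} is closed under both products: [I_{[α]}, I_{[α]}] + I_{[α]}·I_{[α]} ⊆ I_{[α]}. -/

import Mathlib

/-- A (regular, with distinguished maximal abelian graded subalgebra `H`)
BiHom-Poisson superalgebra over a field `K`. -/
structure BHPS (K A : Type*) [Field K] [AddCommGroup A] [Module K A] where
  /-- the ℤ₂-grading -/
  grade : ZMod 2 → Submodule K A
  gradeInternal : DirectSum.IsInternal grade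
  /-- the bracket -/
  br : A →ₗ[K] A →ₗ[K] A
  /-- the associative-type product -/
  mu : A →ₗ[K] A →ₗ[K] A
  /-- the first structure map -/
  phi : A ≃ₗ[K] A
  /-- the second structure map -/
  psi : A ≃ₗ[K] A
  br_grade : ∀ (i j : ZMod 2), ∀ x ∈ grade i, ∀ y ∈ grade j, br x y ∈ grade (i + j)
  mu_grade : ∀ (i j : ZMod 2), ∀ x ∈ grade i, ∀ y ∈ grade j, mu x y ∈ grade (i + j)
  phi_grade : ∀ i, (grade i).map (phi : A →ₗ[K] A) = grade i
  psi_grade : ∀ i, (grade i).map (psi : A →ₗ[K] A) = grade i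
  phi_psi_comm : ∀ x, phi (psi x) = psi (phi x)
  phi_br : ∀ x y, phi (br x y) = br (phi x) (phi y)
  psi_br : ∀ x y, psi (br x y) = br (psi x) (psi y)
  phi_mu : ∀ x y, phi (mu x y) = mu (phi x) (phi y)
  psi_mu : ∀ x y, psi (mu x y) = mu (psi x) (psi y)
  skew : ∀ (i j : ZMod 2), ∀ x ∈ grade i, ∀ y ∈ grade j,
    br (psi x) (phi y) = -((-1 : K) ^ (i.val * j.val)) • br (psi y) (phi x)
  jacobi : ∀ (i j k : ZMod 2), ∀ x ∈ grade i, ∀ y ∈ grade j, ∀ z ∈ grade k,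
    ((-1 : K) ^ (i.val * k.val)) • br (psi (psi x)) (br (psi y) (phi z))
      + ((-1 : K) ^ (i.val * j.val)) • br (psi (psi y)) (br (psi z) (phi x))
      + ((-1 : K) ^ (j.val * k.val)) • br (psi (psi z)) (br (psi x) (phi y)) = 0
  assoc : ∀ x y z, mu (phi x) (mu y z) = mu (mu x y) (psi z)
  leibniz : ∀ (j k : ZMod 2), ∀ (x : A), ∀ y ∈ grade j, ∀ z ∈ grade k,
    br (mu x y) (phi (psi z))
      = mu (phi x) (br y (phi z)) + ((-1 : K) ^ (j.val * k.val)) • mu (br x (psi z)) (phi y)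
  /-- the maximal abelian graded subalgebra -/
  H : Submodule K A
  H_graded : H = (H ⊓ grade 0) ⊔ (H ⊓ grade 1)
  H_abelian : ∀ x ∈ H, ∀ y ∈ H, br x y = 0
  phi_H : H.map (phi : A →ₗ[K] A) = H
  psi_H : H.map (psi : A →ₗ[K] A) = H
  H_max : ∀ H' : Submodule K A, H ≤ H' →
    H' = (H' ⊓ grade 0) ⊔ (H' ⊓ grade 1) →
    (∀ x ∈ H', ∀ y ∈ H', br x y = 0) →
    H'.map (phi : A →ₗ[K] A) = H' → H'.map (psi : A →ₗ[K] A) = H' → H' = H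

namespace BHPS

variable {K A : Type*} [Field K] [AddCommGroup A] [Module K A] (D : BHPS K A)

/-- The even part `H₀` of `H`. -/
def H0 : Submodule K A := D.H ⊓ D.grade 0

lemma phi_H0 : D.H0.map (D.phi : A →ₗ[K] A) = D.H0 := by
  unfold H0
  rw [Submodule.map_inf (D.phi : A →ₗ[K] A) D.phi.injective, D.phi_H, D.phi_grade]

lemma psi_H0 : D.H0.map (D.psi : A →ₗ[K] A) = D.H0 := by
  unfold H0
  rw [Submodule.map_inf (D.psi : A →ₗ[K] A) D.psi.injective, D.psi_H, D.psi_grade]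

/-- The restriction of `φ` to `H₀`, as a linear automorphism. -/
def phiH0 : ↥D.H0 ≃ₗ[K] ↥D.H0 :=
  (D.phi.submoduleMap D.H0).trans (LinearEquiv.ofEq _ _ D.phi_H0)

/-- The restriction of `ψ` to `H₀`, as a linear automorphism. -/
def psiH0 : ↥D.H0 ≃ₗ[K] ↥D.H0 :=
  (D.psi.submoduleMap D.H0).trans (LinearEquiv.ofEq _ _ D.psi_H0)

/-- The root space attached to a linear functional `α : H₀ → K`:
`A_α = {v : [h, φ(v)] = α(h) • φψ(v) for all h ∈ H₀}`. -/
def rootSpace (α : Module.Dual K ↥D.H0) : Submodule K A where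
  carrier := {v | ∀ h : ↥D.H0, D.br (h : A) (D.phi v) = α h • D.phi (D.psi v)}
  add_mem' := by
    intro a b ha hb h
    simp only [map_add, ha h, hb h, smul_add]
  zero_mem' := by
    intro h
    simp
  smul_mem' := by
    intro c v hv h
    simp only [map_smul, hv h]
    rw [smul_comm]

/-- The root system `Λ`. -/
def roots : Set (Module.Dual K ↥D.H0) := {α | α ≠ 0 ∧ D.rootSpace α ≠ ⊥}

/-- `A` is split with respect to `H`: `A = H ⊕ (⊕_{α ∈ Λ} A_α)`. -/
def IsSplit : Prop :=
  letI := Classical.decEq (Option ↥D.roots)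
  DirectSum.IsInternal (fun o : Option ↥D.roots => o.elim D.H fun α => D.rootSpace α.1)

/-- `α ∘ φ^{z₁} ∘ ψ^{z₂}`. -/
def twist (z₁ z₂ : ℤ) (γ : Module.Dual K ↥D.H0) : Module.Dual K ↥D.H0 :=
  γ ∘ₗ ((((D.phiH0 ^ z₁) : ↥D.H0 ≃ₗ[K] ↥D.H0) : ↥D.H0 →ₗ[K] ↥D.H0) ∘ₗ
        (((D.psiH0 ^ z₂) : ↥D.H0 ≃ₗ[K] ↥D.H0) : ↥D.H0 →ₗ[K] ↥D.H0))

/-- `±S = S ∪ (-S)`. -/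
def pm (S : Set (Module.Dual K ↥D.H0)) : Set (Module.Dual K ↥D.H0) :=
  S ∪ (Neg.neg '' S)

/-- The partial sums `α₁∘φ^{-i} + α₂∘φ^{-i+1}∘ψ^{-1} + ⋯ + α_i∘φ^{-1}∘ψ^{-1} + α_{i+1}∘ψ^{-1}`
appearing in the definition of a connection. -/
def chainSum (a : ℕ → Module.Dual K ↥D.H0) (i : ℕ) : Module.Dual K ↥D.H0 :=
  D.twist (-(i : ℤ)) 0 (a 1)
    + ∑ t ∈ Finset.Icc 2 (i + 1), D.twist (-((i : ℤ) + 1 - (t : ℤ))) (-1) (a t)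

/-- `a 1, …, a k` is a connection from `α` to `β` (relative to the set of roots `S`). -/
def IsConnectionIn (S : Set (Module.Dual K ↥D.H0)) (α β : Module.Dual K ↥D.H0)
    (k : ℕ) (a : ℕ → Module.Dual K ↥D.H0) : Prop :=
  2 ≤ k ∧
  (∀ t, 1 ≤ t → t ≤ k → a t ∈ D.pm S) ∧
  (∃ n r : ℕ, a 1 = D.twist (-(n : ℤ)) (-(r : ℤ)) α) ∧
  (∀ i, 1 ≤ i → i ≤ k - 2 → D.chainSum a i ∈ D.pm S) ∧
  (∃ m s : ℕ, D.chainSum a (k - 1) = D.twist (-(m : ℤ)) (-(s : ℤ)) β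
      ∨ D.chainSum a (k - 1) = -(D.twist (-(m : ℤ)) (-(s : ℤ)) β))

/-- `α` is connected to `β` (relative to the set of roots `S`). -/
def ConnectedIn (S : Set (Module.Dual K ↥D.H0)) (α β : Module.Dual K ↥D.H0) : Prop :=
  (∃ z₁ z₂ : ℤ, ∃ ε : K, (ε = 1 ∨ ε = -1) ∧ β = ε • D.twist z₁ z₂ α) ∨
  (∃ k a, D.IsConnectionIn S α β k a)

/-- `α` is connected to `β`. -/
def Connected (α β : Module.Dual K ↥D.H0) : Prop := D.ConnectedIn D.roots α β

/-- The set `[α]` of roots connected to `α`. -/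
def classSet (α : Module.Dual K ↥D.H0) : Set (Module.Dual K ↥D.H0) :=
  {β ∈ D.roots | D.Connected α β}

/-- `I_{H,[α]} = span {[A_{β∘ψ⁻¹}, A_{−β∘φ⁻¹}] + A_{β∘ψ⁻¹}·A_{−β∘φ⁻¹} : β ∈ [α]}`. -/
def IH (α : Module.Dual K ↥D.H0) : Submodule K A :=
  ⨆ β ∈ D.classSet α,
    (Submodule.map₂ D.br (D.rootSpace (D.twist 0 (-1) β)) (D.rootSpace (-(D.twist (-1) 0 β)))
      ⊔ Submodule.map₂ D.mu (D.rootSpace (D.twist 0 (-1) β)) (D.rootSpace (-(D.twist (-1) 0 β))))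

/-- `V_{[α]} = ⊕_{β ∈ [α]} A_β`. -/
def VS (α : Module.Dual K ↥D.H0) : Submodule K A :=
  ⨆ β ∈ D.classSet α, D.rootSpace β

/-- `I_{[α]} = I_{H,[α]} ⊕ V_{[α]}`. -/
def Iclass (α : Module.Dual K ↥D.H0) : Submodule K A := D.IH α ⊔ D.VS α

/-- `J` is an ideal of the (sub)algebra `I`. -/
def IsIdealIn (J I : Submodule K A) : Prop :=
  J ≤ I ∧ J = (J ⊓ D.grade 0) ⊔ (J ⊓ D.grade 1) ∧
  Submodule.map₂ D.br J I ≤ J ∧ Submodule.map₂ D.mu J I ≤ J ∧ Submodule.map₂ D.mu I J ≤ J ∧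
  J.map (D.phi : A →ₗ[K] A) = J ∧ J.map (D.psi : A →ₗ[K] A) = J

/-- `I` is an ideal of `A`: `[I,A] + I·A + A·I ⊆ I`, graded and `φ,ψ`-invariant. -/
def IsIdeal (I : Submodule K A) : Prop := D.IsIdealIn I ⊤

/-- `A` is simple: `[A,A] + A·A ≠ 0` and its only ideals are `0` and `A`. -/
def IsSimple : Prop :=
  (Submodule.map₂ D.br ⊤ ⊤ ⊔ Submodule.map₂ D.mu (⊤ : Submodule K A) ⊤ ≠ ⊥) ∧
  ∀ I : Submodule K A, D.IsIdeal I → I = ⊥ ∨ I = ⊤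

/-- The center `Z(A) = {v : [v,A] + v·A + A·v = 0}`. -/
def center : Submodule K A where
  carrier := {v | ∀ w, D.br v w = 0 ∧ D.mu v w = 0 ∧ D.mu w v = 0}
  add_mem' := by
    intro a b ha hb w
    obtain ⟨h1, h2, h3⟩ := ha w
    obtain ⟨g1, g2, g3⟩ := hb w
    simp [map_add, LinearMap.add_apply, h1, h2, h3, g1, g2, g3]
  zero_mem' := by intro w; simp
  smul_mem' := by
    intro c v hv w
    obtain ⟨h1, h2, h3⟩ := hv w
    simp [map_smul, LinearMap.smul_apply, h1, h2, h3]

/-- `Σ_{α∈Λ} ([A_{α∘ψ⁻¹}, A_{−α∘φ⁻¹}] + A_{α∘ψ⁻¹}·A_{−α∘φ⁻¹})`. -/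
def HSum : Submodule K A :=
  ⨆ α ∈ D.roots,
    (Submodule.map₂ D.br (D.rootSpace (D.twist 0 (-1) α)) (D.rootSpace (-(D.twist (-1) 0 α)))
      ⊔ Submodule.map₂ D.mu (D.rootSpace (D.twist 0 (-1) α)) (D.rootSpace (-(D.twist (-1) 0 α))))

/-- The root system is symmetric. -/
def IsSymmetric : Prop := ∀ α ∈ D.roots, -α ∈ D.roots

/-- `A` is root multiplicative. -/
def RootMultiplicative : Prop :=
  ∀ (i j : ZMod 2) (α β : Module.Dual K ↥D.H0), α ∈ D.roots → β ∈ D.roots →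
    D.rootSpace α ⊓ D.grade i ≠ ⊥ → D.rootSpace β ⊓ D.grade j ≠ ⊥ →
    (D.twist 0 (-1) α + D.twist (-1) 0 β) ∈ D.roots →
    D.rootSpace (D.twist 0 (-1) α + D.twist (-1) 0 β) ⊓ D.grade (i + j) ≠ ⊥ →
    Submodule.map₂ D.br (D.rootSpace α ⊓ D.grade i) (D.rootSpace β ⊓ D.grade j)
      ⊔ Submodule.map₂ D.mu (D.rootSpace α ⊓ D.grade i) (D.rootSpace β ⊓ D.grade j) ≠ ⊥

/-- `A` is of maximal length: every nonzero graded root space is one-dimensional. -/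
def MaximalLength : Prop :=
  ∀ (i : ZMod 2), ∀ α ∈ D.roots, D.rootSpace α ⊓ D.grade i ≠ ⊥ →
    Module.rank K ↥(D.rootSpace α ⊓ D.grade i) = 1

end BHPS

namespace BHPS

variable {K A : Type*} [Field K] [AddCommGroup A] [Module K A] (D : BHPS K A)

@[simp] lemma coe_phiH0 (h : ↥D.H0) : ((D.phiH0 h : ↥D.H0) : A) = D.phi h := rfl

@[simp] lemma coe_psiH0 (h : ↥D.H0) : ((D.psiH0 h : ↥D.H0) : A) = D.psi h := rfl

lemma commute_phiH0_psiH0 : Commute D.phiH0 D.psiH0 :=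
  LinearEquiv.ext fun h => Subtype.ext (D.phi_psi_comm h)

section Twist

variable (z₁ z₂ : ℤ) (γ δ : Module.Dual K ↥D.H0)

lemma twist_apply (h : ↥D.H0) :
    D.twist z₁ z₂ γ h = γ ((D.phiH0 ^ z₁ * D.psiH0 ^ z₂) h) := rfl

@[simp] lemma twist_add : D.twist z₁ z₂ (γ + δ) = D.twist z₁ z₂ γ + D.twist z₁ z₂ δ := rfl

@[simp] lemma twist_neg : D.twist z₁ z₂ (-γ) = -D.twist z₁ z₂ γ := rfl

@[simp] lemma twist_smul (c : K) : D.twist z₁ z₂ (c • γ) = c • D.twist z₁ z₂ γ := rfl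

@[simp] lemma twist_zero : D.twist z₁ z₂ 0 = 0 := rfl

@[simp] lemma twist_zero_zero : D.twist 0 0 γ = γ := rfl

@[simp] lemma twist_twist (w₁ w₂ : ℤ) :
    D.twist z₁ z₂ (D.twist w₁ w₂ γ) = D.twist (z₁ + w₁) (z₂ + w₂) γ := by
  ext h
  have hc : Commute (D.phiH0 ^ z₁) (D.psiH0 ^ w₂) :=
    (D.commute_phiH0_psiH0.zpow_left z₁).zpow_right w₂
  rw [twist_apply, twist_apply, twist_apply, ← LinearEquiv.mul_apply, add_comm z₁, add_comm z₂,
    zpow_add, zpow_add, mul_assoc, ← mul_assoc (D.psiH0 ^ w₂), ← hc.eq]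
  simp only [mul_assoc]

lemma twist_sum {ι : Type*} (s : Finset ι) (f : ι → Module.Dual K ↥D.H0) :
    D.twist z₁ z₂ (∑ t ∈ s, f t) = ∑ t ∈ s, D.twist z₁ z₂ (f t) := by
  induction s using Finset.cons_induction with
  | empty => simp
  | cons t s ht ih => simp [ih]

@[simp] lemma twist_one_zero_apply (h : ↥D.H0) : D.twist 1 0 γ h = γ (D.phiH0 h) := by
  simp [twist_apply]

@[simp] lemma twist_zero_one_apply (h : ↥D.H0) : D.twist 0 1 γ h = γ (D.psiH0 h) := by
  simp [twist_apply]

lemma twist_neg_one_zero_apply_phiH0 (h : ↥D.H0) : D.twist (-1) 0 γ (D.phiH0 h) = γ h := by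
  rw [← twist_one_zero_apply]; simp

lemma twist_zero_neg_one_apply_psiH0 (h : ↥D.H0) : D.twist 0 (-1) γ (D.psiH0 h) = γ h := by
  rw [← twist_zero_one_apply]; simp

end Twist

lemma mem_rootSpace {γ : Module.Dual K ↥D.H0} {v : A} :
    v ∈ D.rootSpace γ ↔ ∀ h : ↥D.H0, D.br (h : A) (D.phi v) = γ h • D.phi (D.psi v) := Iff.rfl

section StructureMaps

variable {γ : Module.Dual K ↥D.H0} {v : A}

lemma phi_mem_rootSpace_iff : D.phi v ∈ D.rootSpace (D.twist (-1) 0 γ) ↔ v ∈ D.rootSpace γ := by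
  rw [mem_rootSpace, mem_rootSpace, D.phiH0.surjective.forall]
  refine forall_congr' fun h => ?_
  rw [twist_neg_one_zero_apply_phiH0, coe_phiH0, ← D.phi_br, ← D.phi_psi_comm, ← map_smul,
    D.phi.injective.eq_iff]

lemma psi_mem_rootSpace_iff : D.psi v ∈ D.rootSpace (D.twist 0 (-1) γ) ↔ v ∈ D.rootSpace γ := by
  rw [mem_rootSpace, mem_rootSpace, D.psiH0.surjective.forall]
  refine forall_congr' fun h => ?_
  rw [twist_zero_neg_one_apply_psiH0, coe_psiH0, D.phi_psi_comm v, ← D.psi_br,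
    ← D.phi_psi_comm v, D.phi_psi_comm (D.psi v), ← map_smul, D.psi.injective.eq_iff]

lemma phi_symm_mem_rootSpace (hv : v ∈ D.rootSpace γ) :
    D.phi.symm v ∈ D.rootSpace (D.twist 1 0 γ) := by
  rw [← phi_mem_rootSpace_iff]; simpa

lemma psi_symm_mem_rootSpace (hv : v ∈ D.rootSpace γ) :
    D.psi.symm v ∈ D.rootSpace (D.twist 0 1 γ) := by
  rw [← psi_mem_rootSpace_iff]; simpa

end StructureMaps

section Roots

/-- `neg_one_smul` restated so that `simp` sees through the instances on `Module.Dual`. -/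
lemma neg_one_smul_dual (γ : Module.Dual K ↥D.H0) : (-1 : K) • γ = -γ := neg_one_smul K γ

variable {γ : Module.Dual K ↥D.H0}

lemma twist_ne_zero (z₁ z₂ : ℤ) (hγ : γ ≠ 0) : D.twist z₁ z₂ γ ≠ 0 := fun h => hγ <| by
  simpa using congrArg (D.twist (-z₁) (-z₂)) h

lemma mem_roots_of_mem_rootSpace {v : A} (hγ : γ ≠ 0) (hv : v ∈ D.rootSpace γ) (hv0 : v ≠ 0) :
    γ ∈ D.roots :=
  ⟨hγ, fun h => hv0 <| by simpa [h] using hv⟩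

lemma twist_mem_roots (z₁ z₂ : ℤ) (hγ : γ ∈ D.roots) : D.twist z₁ z₂ γ ∈ D.roots := by
  have hφ : ∀ γ ∈ D.roots, D.twist (-1) 0 γ ∈ D.roots ∧ D.twist 1 0 γ ∈ D.roots := by
    rintro γ ⟨h0, hne⟩
    obtain ⟨v, hv, hv0⟩ := Submodule.exists_mem_ne_zero_of_ne_bot hne
    exact ⟨D.mem_roots_of_mem_rootSpace (D.twist_ne_zero _ _ h0) (D.phi_mem_rootSpace_iff.2 hv)
        (by simpa), D.mem_roots_of_mem_rootSpace (D.twist_ne_zero _ _ h0)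
        (D.phi_symm_mem_rootSpace hv) (by simpa)⟩
  have hψ : ∀ γ ∈ D.roots, D.twist 0 (-1) γ ∈ D.roots ∧ D.twist 0 1 γ ∈ D.roots := by
    rintro γ ⟨h0, hne⟩
    obtain ⟨v, hv, hv0⟩ := Submodule.exists_mem_ne_zero_of_ne_bot hne
    exact ⟨D.mem_roots_of_mem_rootSpace (D.twist_ne_zero _ _ h0) (D.psi_mem_rootSpace_iff.2 hv)
        (by simpa), D.mem_roots_of_mem_rootSpace (D.twist_ne_zero _ _ h0)
        (D.psi_symm_mem_rootSpace hv) (by simpa)⟩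
  have hψz : D.twist 0 z₂ γ ∈ D.roots := by
    induction z₂ with
    | zero => simpa
    | succ n ih => simpa [add_comm] using (hψ _ ih).2
    | pred n ih => simpa [sub_eq_neg_add] using (hψ _ ih).1
  have hz : D.twist z₁ 0 (D.twist 0 z₂ γ) ∈ D.roots := by
    induction z₁ with
    | zero => simpa
    | succ n ih => simpa [add_comm] using (hφ _ ih).2
    | pred n ih => simpa [sub_eq_neg_add] using (hφ _ ih).1
  simpa using hz

lemma mem_pm {S : Set (Module.Dual K ↥D.H0)} : γ ∈ D.pm S ↔ γ ∈ S ∨ -γ ∈ S := by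
  simp [pm]

lemma twist_mem_pm_roots (z₁ z₂ : ℤ) (hγ : γ ∈ D.pm D.roots) :
    D.twist z₁ z₂ γ ∈ D.pm D.roots := by
  rw [mem_pm] at *
  rw [← twist_neg]
  exact hγ.imp (D.twist_mem_roots _ _) (D.twist_mem_roots _ _)

lemma smul_mem_pm_roots {ε : K} (hε : ε = 1 ∨ ε = -1) (hγ : γ ∈ D.roots) :
    ε • γ ∈ D.pm D.roots := by
  rw [mem_pm]
  rcases hε with rfl | rfl <;> simp [hγ, neg_one_smul_dual]

end Roots

section Connections

lemma chainSum_succ (a : ℕ → Module.Dual K ↥D.H0) (i : ℕ) :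
    D.chainSum a (i + 1) = D.twist (-1) 0 (D.chainSum a i) + D.twist 0 (-1) (a (i + 2)) := by
  rw [chainSum, chainSum, Finset.sum_Icc_succ_top (by lia), twist_add, twist_sum, ← add_assoc]
  congr 1
  · congr 1
    · simp
    · refine Finset.sum_congr rfl fun t _ => ?_
      rw [twist_twist]
      congr 1
      push_cast; ring
  · congr 1
    push_cast; ring

lemma chainSum_congr {a b : ℕ → Module.Dual K ↥D.H0} {i : ℕ}
    (h : ∀ t, 1 ≤ t → t ≤ i + 1 → a t = b t) : D.chainSum a i = D.chainSum b i := by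
  rw [chainSum, chainSum, h 1 le_rfl (by lia)]
  congr 1
  refine Finset.sum_congr rfl fun t ht => ?_
  rw [Finset.mem_Icc] at ht
  rw [h t (by lia) ht.2]

lemma chainSum_twist (z₁ z₂ : ℤ) (a : ℕ → Module.Dual K ↥D.H0) (i : ℕ) :
    D.chainSum (fun t => D.twist z₁ z₂ (a t)) i = D.twist z₁ z₂ (D.chainSum a i) := by
  simp only [chainSum, twist_add, twist_sum, twist_twist, add_comm]

@[simp] lemma chainSum_zero (a : ℕ → Module.Dual K ↥D.H0) : D.chainSum a 0 = a 1 := by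
  simp [chainSum]

variable {α β γ : Module.Dual K ↥D.H0}

lemma eq_or_eq_neg_iff_exists_sign {δ : Module.Dual K ↥D.H0} :
    (δ = γ ∨ δ = -γ) ↔ ∃ ε : K, (ε = 1 ∨ ε = -1) ∧ δ = ε • γ := by
  simp only [or_and_right, exists_or, exists_eq_left, one_smul, neg_one_smul_dual]

lemma twist_mem_classSet (z₁ z₂ : ℤ) (hβ : β ∈ D.classSet α) :
    D.twist z₁ z₂ β ∈ D.classSet α := by
  refine ⟨D.twist_mem_roots z₁ z₂ hβ.1, ?_⟩
  obtain ⟨-, ⟨w₁, w₂, ε, hε, rfl⟩ | ⟨k, a, hk, ha, ⟨n, r, h1⟩, hi, m, s, hend⟩⟩ := hβ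
  · exact .inl ⟨z₁ + w₁, z₂ + w₂, ε, hε, by simp⟩
  · refine .inr ⟨k, fun t => D.twist (-z₁.natAbs) (-z₂.natAbs) (a t), hk,
      fun t ht htk => D.twist_mem_pm_roots _ _ (ha t ht htk),
      ⟨z₁.natAbs + n, z₂.natAbs + r, ?_⟩, fun i h1 h2 => ?_,
      (z₁ + z₁.natAbs).toNat + m, (z₂ + z₂.natAbs).toNat + s, ?_⟩
    · simp only [h1, twist_twist]
      congr 1 <;> push_cast <;> ring
    · rw [chainSum_twist]
      exact D.twist_mem_pm_roots _ _ (hi i h1 h2)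
    · have e₁ : -(((z₁ + z₁.natAbs).toNat + m : ℕ) : ℤ) + z₁ = -z₁.natAbs + -m := by lia
      have e₂ : -(((z₂ + z₂.natAbs).toNat + s : ℕ) : ℤ) + z₂ = -z₂.natAbs + -s := by lia
      rw [chainSum_twist, twist_twist, e₁, e₂]
      refine hend.imp (fun h => ?_) (fun h => ?_) <;> simp [h]

lemma add_mem_classSet (hβ : β ∈ D.classSet α) (hγ : γ ∈ D.roots)
    (hδ : D.twist (-1) 0 β + D.twist 0 (-1) γ ∈ D.roots) :
    D.twist (-1) 0 β + D.twist 0 (-1) γ ∈ D.classSet α := by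
  refine ⟨hδ, .inr ?_⟩
  obtain ⟨hβr, ⟨w₁, w₂, ε, hε, hβ⟩ | ⟨k, a, hk, ha, h1, hi, m, s, hend⟩⟩ := hβ
  · have hεε : ε * ε = 1 := by rcases hε with rfl | rfl <;> simp
    have hα : ε • D.twist (-w₁.natAbs) (-w₂.natAbs) β
        = D.twist (-((w₁.natAbs - w₁).toNat : ℕ)) (-((w₂.natAbs - w₂).toNat : ℕ)) α := by
      rw [hβ, twist_smul, smul_smul, hεε, one_smul, twist_twist]
      congr 1 <;> lia
    have hsum : D.chainSum (fun t => ε • D.twist (-w₁.natAbs) (-w₂.natAbs)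
        (if t = 1 then β else γ)) 1
        = ε • D.twist (-w₁.natAbs) (-w₂.natAbs) (D.twist (-1) 0 β + D.twist 0 (-1) γ) := by
      rw [D.chainSum_succ _ 0]
      simp [add_comm]
    refine ⟨2, _, le_rfl, fun t _ _ => D.smul_mem_pm_roots hε (D.twist_mem_roots
      (-w₁.natAbs) (-w₂.natAbs) (?_ : (if t = 1 then β else γ) ∈ _)), ⟨_, _, hα⟩,
      fun i _ _ => by lia, w₁.natAbs, w₂.natAbs, ?_⟩
    · split_ifs <;> assumption
    · exact D.eq_or_eq_neg_iff_exists_sign.2 ⟨ε, hε, hsum⟩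
  · obtain ⟨ε, hε, hend⟩ := D.eq_or_eq_neg_iff_exists_sign.1 hend
    set b : ℕ → Module.Dual K ↥D.H0 := fun t =>
      if t ≤ k then a t else ε • D.twist (-m) (-s) γ with hb
    have hab : ∀ i, i + 1 ≤ k → D.chainSum b i = D.chainSum a i := fun i hi =>
      D.chainSum_congr fun t _ ht => if_pos (ht.trans hi)
    obtain ⟨l, rfl⟩ := Nat.exists_eq_add_of_le' hk
    refine ⟨l + 2 + 1, b, by lia, fun t ht _ => ?_, ?_, fun i hi1 hi2 => ?_, m, s, ?_⟩
    · by_cases htk : t ≤ l + 2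
      · simpa [hb, htk] using ha t ht htk
      · simpa [hb, htk] using D.smul_mem_pm_roots hε (D.twist_mem_roots _ _ hγ)
    · simpa [hb] using h1
    · rw [hab i (by lia)]
      by_cases hil : i ≤ l
      · exact hi i hi1 hil
      · obtain rfl : i = l + 1 := by lia
        rw [show l + 1 = l + 2 - 1 from rfl, hend]
        exact D.smul_mem_pm_roots hε (D.twist_mem_roots _ _ hβr)
    · refine D.eq_or_eq_neg_iff_exists_sign.2 ⟨ε, hε, ?_⟩
      rw [show l + 2 + 1 - 1 = l + 1 + 1 from rfl, chainSum_succ, hab _ le_rfl,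
        show l + 1 = l + 2 - 1 from rfl, hend]
      simp [hb, add_comm]

end Connections

section Grading

lemma exists_add_of_grade (v : A) : ∃ x ∈ D.grade 0, ∃ y ∈ D.grade 1, x + y = v := by
  have h : D.grade 0 ⊔ D.grade 1 = ⊤ := by
    rw [← D.gradeInternal.submodule_iSup_eq_top]
    exact le_antisymm (sup_le (le_iSup D.grade 0) (le_iSup D.grade 1))
      (iSup_le fun i => by fin_cases i; exacts [le_sup_left, le_sup_right])
  exact Submodule.mem_sup.1 (h ▸ Submodule.mem_top)

lemma eq_zero_of_grade_add_eq_zero {x y : A} (hx : x ∈ D.grade 0) (hy : y ∈ D.grade 1)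
    (h : x + y = 0) : x = 0 ∧ y = 0 := by
  have hd : Disjoint (D.grade 0) (D.grade 1) :=
    D.gradeInternal.submodule_iSupIndep.pairwiseDisjoint (by decide)
  have hx0 : x = 0 := Submodule.disjoint_def.1 hd x hx <| by
    rw [eq_neg_of_add_eq_zero_left h]; exact neg_mem hy
  exact ⟨hx0, by simpa [hx0] using h⟩

lemma phi_mem_grade {i : ZMod 2} {x : A} (hx : x ∈ D.grade i) : D.phi x ∈ D.grade i :=
  D.phi_grade i ▸ Submodule.mem_map_of_mem hx

lemma psi_mem_grade {i : ZMod 2} {x : A} (hx : x ∈ D.grade i) : D.psi x ∈ D.grade i :=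
  D.psi_grade i ▸ Submodule.mem_map_of_mem hx

lemma rootSpace_graded {γ : Module.Dual K ↥D.H0} {v : A} (hv : v ∈ D.rootSpace γ) :
    ∃ x ∈ D.rootSpace γ ⊓ D.grade 0, ∃ y ∈ D.rootSpace γ ⊓ D.grade 1, x + y = v := by
  obtain ⟨x, hx, y, hy, rfl⟩ := D.exists_add_of_grade v
  have key : ∀ h : ↥D.H0, D.br (h : A) (D.phi x) - γ h • D.phi (D.psi x) = 0 ∧
      D.br (h : A) (D.phi y) - γ h • D.phi (D.psi y) = 0 := fun h => by
    have hmem : ∀ i, ∀ u ∈ D.grade i,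
        D.br (h : A) (D.phi u) - γ h • D.phi (D.psi u) ∈ D.grade i := fun i u hu =>
      sub_mem (by simpa using D.br_grade 0 i h h.2.2 _ (D.phi_mem_grade hu))
        (Submodule.smul_mem _ _ (D.phi_mem_grade (D.psi_mem_grade hu)))
    refine D.eq_zero_of_grade_add_eq_zero (hmem 0 x hx) (hmem 1 y hy) ?_
    have := hv h
    simp only [map_add, smul_add] at this
    rw [sub_add_sub_comm, this, sub_self]
  exact ⟨x, ⟨fun h => sub_eq_zero.1 (key h).1, hx⟩, y, ⟨fun h => sub_eq_zero.1 (key h).2, hy⟩, rfl⟩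

lemma rootSpace_induction {γ : Module.Dual K ↥D.H0} {p : A → Prop}
    (hom : ∀ i, ∀ x ∈ D.rootSpace γ, x ∈ D.grade i → p x)
    (add : ∀ x y, p x → p y → p (x + y)) {v : A} (hv : v ∈ D.rootSpace γ) : p v := by
  obtain ⟨x, hx, y, hy, rfl⟩ := D.rootSpace_graded hv
  exact add _ _ (hom 0 x hx.1 hx.2) (hom 1 y hy.1 hy.2)

lemma skew_H0 (y : A) (h : ↥D.H0) :
    D.br (D.psi y) (D.phi h) = -D.br (D.psi h) (D.phi y) := by
  obtain ⟨y₀, hy₀, y₁, hy₁, rfl⟩ := D.exists_add_of_grade y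
  have h₀ := D.skew 0 0 y₀ hy₀ h h.2.2
  have h₁ := D.skew 1 0 y₁ hy₁ h h.2.2
  simp only [ZMod.val_zero, mul_zero, pow_zero, neg_smul, one_smul] at h₀ h₁
  simp only [map_add, LinearMap.add_apply, h₀, h₁, neg_add]

end Grading

section Products

variable {α β : Module.Dual K ↥D.H0} {x y : A}

lemma br_psi_of_mem_rootSpace (hy : y ∈ D.rootSpace β) (h : ↥D.H0) :
    D.br (D.psi y) (D.phi h) = -(β (D.psiH0 h) • D.phi (D.psi y)) := by
  rw [skew_H0, ← coe_psiH0, hy]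

lemma br_mem_rootSpace_aux {j k : ZMod 2} (hx : x ∈ D.rootSpace α) (hxj : x ∈ D.grade j)
    (hy : y ∈ D.rootSpace β) (hyk : y ∈ D.grade k) (h : ↥D.H0) :
    D.br (D.psi (D.psi h)) (D.br (D.psi x) (D.phi y))
      = (α (D.psiH0 h) + β (D.psiH0 h)) • D.psi (D.br (D.psi x) (D.phi y)) := by
  have hj := D.jacobi 0 j k h h.2.2 x hxj y hyk
  have hs := D.skew k j _ (D.psi_mem_grade hyk) _ (D.psi_mem_grade hxj)
  have hsq : (-1 : K) ^ (j.val * k.val) * (-1 : K) ^ (k.val * j.val) = 1 := by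
    rw [mul_comm k.val, ← mul_pow]; simp
  rw [D.br_psi_of_mem_rootSpace hy h, ← coe_psiH0, hx, map_smul, hs, map_neg, map_smul,
    smul_comm (α _), smul_smul, mul_neg, hsq] at hj
  simp only [ZMod.val_zero, zero_mul, pow_zero, one_smul, neg_smul] at hj
  rw [D.psi_br, ← D.phi_psi_comm, add_smul, ← coe_psiH0, ← sub_eq_zero, ← hj]
  abel

lemma br_psi_phi_mem_rootSpace (hx : x ∈ D.rootSpace α) (hy : y ∈ D.rootSpace β) :
    D.br (D.psi x) (D.phi y) ∈ D.rootSpace (D.twist (-1) (-1) (α + β)) := by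
  refine D.rootSpace_induction (p := fun x => D.br (D.psi x) (D.phi y) ∈ _)
    (fun j x hx hxj => ?_) (fun _ _ h₁ h₂ => by simpa using add_mem h₁ h₂) hx
  refine D.rootSpace_induction (p := fun y => D.br (D.psi x) (D.phi y) ∈ _)
    (fun k y hy hyk => ?_) (fun _ _ h₁ h₂ => by simpa using add_mem h₁ h₂) hy
  intro h
  obtain ⟨h, rfl⟩ := D.phiH0.surjective h
  obtain ⟨h, rfl⟩ := D.psiH0.surjective h
  obtain ⟨h, rfl⟩ := D.psiH0.surjective h
  have ht : D.twist (-1) (-1) (α + β) = D.twist (-1) 0 (D.twist 0 (-1) (α + β)) := by simp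
  rw [ht, twist_neg_one_zero_apply_phiH0, twist_zero_neg_one_apply_psiH0, coe_phiH0, ← D.phi_br,
    coe_psiH0, coe_psiH0, D.br_mem_rootSpace_aux hx hxj hy hyk, map_smul, LinearMap.add_apply]

lemma br_mem_rootSpace (hx : x ∈ D.rootSpace α) (hy : y ∈ D.rootSpace β) :
    D.br x y ∈ D.rootSpace (D.twist (-1) 0 α + D.twist 0 (-1) β) := by
  simpa using D.br_psi_phi_mem_rootSpace (D.psi_symm_mem_rootSpace hx)
    (D.phi_symm_mem_rootSpace hy)

lemma mem_rootSpace_iff_br_psi :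
    x ∈ D.rootSpace α ↔
      ∀ h : ↥D.H0, D.br (D.psi x) (D.phi h) = -(α (D.psiH0 h) • D.phi (D.psi x)) := by
  rw [mem_rootSpace, D.psiH0.surjective.forall]
  simp only [skew_H0, neg_inj, coe_psiH0]

lemma mu_mem_rootSpace (hx : x ∈ D.rootSpace α) (hy : y ∈ D.rootSpace β) :
    D.mu x y ∈ D.rootSpace (D.twist (-1) 0 α + D.twist 0 (-1) β) := by
  refine D.rootSpace_induction (p := fun y => D.mu x y ∈ _)
    (fun k y hy hyk => ?_) (fun _ _ h₁ h₂ => by simpa using add_mem h₁ h₂) hy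
  rw [mem_rootSpace_iff_br_psi]
  intro h
  obtain ⟨h, rfl⟩ := D.psiH0.surjective h
  obtain ⟨h, rfl⟩ := D.phiH0.surjective h
  have hcomm : ∀ g, D.psiH0 (D.phiH0 g) = D.phiH0 (D.psiH0 g) := fun g =>
    (LinearEquiv.congr_fun D.commute_phiH0_psiH0.eq g).symm
  have hl := D.leibniz k 0 (D.psi x) (D.psi y) (D.psi_mem_grade hyk) (D.phiH0 h)
    (D.phiH0 h).2.2
  have hxh := D.mem_rootSpace_iff_br_psi.1 hx (D.psiH0 h)
  rw [coe_psiH0, D.phi_psi_comm] at hxh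
  rw [D.mem_rootSpace_iff_br_psi.1 hy, coe_phiH0, hxh] at hl
  simp only [ZMod.val_zero, mul_zero, pow_zero, one_smul, map_neg, map_smul,
    LinearMap.neg_apply, LinearMap.smul_apply] at hl
  rw [D.psi_mu, D.phi_mu, coe_psiH0, coe_phiH0, hl, LinearMap.add_apply,
    twist_zero_neg_one_apply_psiH0, hcomm, hcomm, twist_neg_one_zero_apply_phiH0]
  module

end Products

section ZeroRootSpace

lemma H_le_rootSpace_zero : D.H ≤ D.rootSpace 0 := fun v hv h => by
  rw [LinearMap.zero_apply, zero_smul]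
  exact D.H_abelian _ h.2.1 _ (D.phi_H ▸ Submodule.mem_map_of_mem hv)

lemma rootSpace_zero_le_H (hsplit : D.IsSplit) : D.rootSpace 0 ≤ D.H := by
  let := Classical.decEq (Option ↥D.roots)
  let S : Option ↥D.roots → Submodule K A := fun o => o.elim D.H fun α => D.rootSpace α.1
  let c : Option ↥D.roots → Module.Dual K ↥D.H0 := fun o => o.elim 0 fun α => α.1
  have hS : ∀ o, S o ≤ D.rootSpace (c o) := by
    rintro (_ | α)
    exacts [D.H_le_rootSpace_zero, le_rfl]
  have hint : DirectSum.IsInternal S := hsplit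
  intro v hv
  obtain ⟨f, rfl⟩ := hint.surjective v
  have hbr : ∀ (h : ↥D.H0) (f : DirectSum _ fun o => ↥(S o)),
      D.br (h : A) (D.phi (DirectSum.coeAddMonoidHom S f)) = D.phi (D.psi
        (DirectSum.coeAddMonoidHom S (DirectSum.lmap (fun o => c o h • (LinearMap.id : ↥(S o) →ₗ[K] ↥(S o))) f))) := by
    intro h f
    induction f using DirectSum.induction_on with
    | zero => simp
    | of o x =>
      have := hS o x.2 h
      simp [DirectSum.lmap_of, this]
    | add f g hf hg => simp only [map_add, hf, hg]
  have hzero : ∀ h : ↥D.H0, DirectSum.lmap (fun o => c o h • (LinearMap.id : ↥(S o) →ₗ[K] ↥(S o))) f = 0 := fun h =>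
    hint.injective <| by
      have := hv h
      rw [hbr, LinearMap.zero_apply, zero_smul] at this
      simpa using this
  have hroot : ∀ α : ↥D.roots, f (some α) = 0 := fun α => by
    obtain ⟨h, hh⟩ := DFunLike.ne_iff.1 α.2.1
    have hα : α.1 h • f (some α) = 0 := DFunLike.congr_fun (hzero h) (some α)
    exact (smul_eq_zero.1 hα).resolve_left hh
  have hf : f = DirectSum.of (fun o => ↥(S o)) none (f none) := by
    ext (_ | α)
    · simp
    · rw [hroot, DirectSum.of_eq_of_ne _ _ _ (by simp)]
  rw [hf, DirectSum.coeAddMonoidHom_of]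
  exact (f none).2

end ZeroRootSpace

section Closure

variable {α β γ : Module.Dual K ↥D.H0} {x y z : A}

lemma br_mem_IH (hβ : β ∈ D.classSet α) (hx : x ∈ D.rootSpace (D.twist 0 (-1) β))
    (hy : y ∈ D.rootSpace (-D.twist (-1) 0 β)) : D.br x y ∈ D.IH α :=
  Submodule.mem_iSup_of_mem β <| Submodule.mem_iSup_of_mem hβ <|
    Submodule.mem_sup_left (Submodule.apply_mem_map₂ _ hx hy)

lemma mu_mem_IH (hβ : β ∈ D.classSet α) (hx : x ∈ D.rootSpace (D.twist 0 (-1) β))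
    (hy : y ∈ D.rootSpace (-D.twist (-1) 0 β)) : D.mu x y ∈ D.IH α :=
  Submodule.mem_iSup_of_mem β <| Submodule.mem_iSup_of_mem hβ <|
    Submodule.mem_sup_right (Submodule.apply_mem_map₂ _ hx hy)

lemma IH_le_rootSpace_zero : D.IH α ≤ D.rootSpace 0 := by
  refine iSup₂_le fun β _ => sup_le ?_ ?_ <;> refine Submodule.map₂_le.2 fun x hx y hy => ?_
  · simpa using D.br_mem_rootSpace hx hy
  · simpa using D.mu_mem_rootSpace hx hy

/-- `I_{H,[α]} · A₀ ⊆ I_{H,[α]}`. -/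
lemma mu_IH_rootSpace_zero_mem (hx : x ∈ D.IH α) (hz : z ∈ D.rootSpace 0) :
    D.mu x z ∈ D.IH α := by
  suffices h : D.IH α ≤ (D.IH α).comap (D.mu.flip z) from h hx
  refine iSup₂_le fun β hβ => sup_le ?_ ?_ <;> refine Submodule.map₂_le.2 fun u hu v hv => ?_ <;>
    rw [Submodule.mem_comap, LinearMap.flip_apply]
  all_goals have hβ' := D.twist_mem_classSet (-1) 0 hβ
  · suffices h : D.mu (D.br u (D.psi (D.psi.symm v))) (D.phi (D.phi.symm z)) ∈ D.IH α by
      simpa using h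
    refine D.rootSpace_induction (p := fun z => D.mu (D.br u (D.psi (D.psi.symm v))) (D.phi z) ∈ _)
      (fun j z hz hzj => ?_) (fun _ _ h₁ h₂ => by simpa only [map_add] using add_mem h₁ h₂)
      (D.phi_symm_mem_rootSpace hz)
    refine D.rootSpace_induction (p := fun v => D.mu (D.br u (D.psi v)) (D.phi z) ∈ _)
      (fun k v hv hvk => ?_)
      (fun _ _ h₁ h₂ => by simpa only [map_add, LinearMap.add_apply] using add_mem h₁ h₂)
      (D.psi_symm_mem_rootSpace hv)
    rw [← Submodule.smul_mem_iff _ (pow_ne_zero (j.val * k.val) (neg_ne_zero.2 (one_ne_zero' K))),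
      eq_sub_of_add_eq' (D.leibniz j k u z hzj v hvk).symm]
    refine sub_mem (D.br_mem_IH hβ' ?_ ?_) (D.mu_mem_IH hβ' ?_ ?_)
    · simpa using D.mu_mem_rootSpace hu hz
    · simpa using D.phi_mem_rootSpace_iff.2 (D.psi_mem_rootSpace_iff.2 hv)
    · simpa using D.phi_mem_rootSpace_iff.2 hu
    · simpa using D.br_mem_rootSpace hz (D.phi_mem_rootSpace_iff.2 hv)
  · have hassoc := D.assoc u v (D.psi.symm z)
    rw [LinearEquiv.apply_symm_apply] at hassoc
    rw [← hassoc]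
    refine D.mu_mem_IH hβ' ?_ ?_
    · simpa using D.phi_mem_rootSpace_iff.2 hu
    · simpa using D.mu_mem_rootSpace hv (D.psi_symm_mem_rootSpace hz)

lemma rootSpace_le_VS (hβ : β ∈ D.classSet α) : D.rootSpace β ≤ D.VS α :=
  le_iSup₂_of_le β hβ le_rfl

/-- A bilinear product compatible with root spaces preserves `I_{[α]}` as soon as it sends the
generating pairs of `I_{H,[α]}`, and `I_{H,[α]}` itself, into `I_{H,[α]}`. -/
lemma map₂_Iclass_le (f : A →ₗ[K] A →ₗ[K] A)
    (hf : ∀ β γ, ∀ x ∈ D.rootSpace β, ∀ y ∈ D.rootSpace γ,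
      f x y ∈ D.rootSpace (D.twist (-1) 0 β + D.twist 0 (-1) γ))
    (hroot : ∀ β ∈ D.classSet α, ∀ x ∈ D.rootSpace (D.twist 0 (-1) β),
      ∀ y ∈ D.rootSpace (-D.twist (-1) 0 β), f x y ∈ D.IH α)
    (hIH : ∀ x ∈ D.IH α, ∀ y ∈ D.IH α, f x y ∈ D.IH α) :
    Submodule.map₂ f (D.Iclass α) (D.Iclass α) ≤ D.Iclass α := by
  have hVS : D.VS α ≤ D.Iclass α := le_sup_right
  simp only [Iclass, Submodule.map₂_sup_left, Submodule.map₂_sup_right]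
  refine sup_le (sup_le ?_ ?_) (sup_le ?_ ?_)
  · exact (Submodule.map₂_le.2 hIH).trans le_sup_left
  · simp only [VS, Submodule.map₂_iSup_left]
    refine iSup₂_le fun β hβ => Submodule.map₂_le.2 fun x hx y hy => hVS ?_
    refine D.rootSpace_le_VS (D.twist_mem_classSet (-1) 0 hβ) ?_
    simpa using hf β 0 x hx y (D.IH_le_rootSpace_zero hy)
  · simp only [VS, Submodule.map₂_iSup_right]
    refine iSup₂_le fun γ hγ => Submodule.map₂_le.2 fun x hx y hy => hVS ?_
    refine D.rootSpace_le_VS (D.twist_mem_classSet 0 (-1) hγ) ?_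
    simpa using hf 0 γ x (D.IH_le_rootSpace_zero hx) y hy
  · simp only [VS, Submodule.map₂_iSup_left, Submodule.map₂_iSup_right]
    refine iSup₂_le fun γ hγ => iSup₂_le fun β hβ => Submodule.map₂_le.2 fun x hx y hy => ?_
    have hxy := hf β γ x hx y hy
    by_cases hδ : D.twist (-1) 0 β + D.twist 0 (-1) γ = 0
    · have hγβ : -D.twist (-1) 0 (D.twist 0 1 β) = γ := by
        have := congrArg (D.twist 0 1) (neg_eq_of_add_eq_zero_right hδ)
        simpa using this
      refine Submodule.mem_sup_left (hroot _ (D.twist_mem_classSet 0 1 hβ) x ?_ y ?_)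
      · simpa using hx
      · rwa [hγβ]
    · by_cases h0 : f x y = 0
      · rw [h0]; exact zero_mem _
      · exact hVS (D.rootSpace_le_VS (D.add_mem_classSet hβ hγ.1
          (D.mem_roots_of_mem_rootSpace hδ hxy h0)) hxy)

end Closure

end BHPS

namespace BHPS

variable {K A : Type*}

/-- `[I_{[α]}, I_{[α]}] + I_{[α]}·I_{[α]} ⊆ I_{[α]}`. -/
theorem Iclass_closed {K A : Type*} [Field K] [AddCommGroup A] [Module K A] (D : BHPS K A)
    (hsplit : D.IsSplit)
    (α : Module.Dual K ↥D.H0) (hα : α ∈ D.roots) :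
    Submodule.map₂ D.br (D.Iclass α) (D.Iclass α)
      ⊔ Submodule.map₂ D.mu (D.Iclass α) (D.Iclass α) ≤ D.Iclass α := by
  refine sup_le ?_ ?_
  · refine D.map₂_Iclass_le D.br (fun β γ x hx y hy => D.br_mem_rootSpace hx hy)
      (fun β hβ x hx y hy => D.br_mem_IH hβ hx hy) fun x hx y hy => ?_
    rw [D.H_abelian x (D.rootSpace_zero_le_H hsplit (D.IH_le_rootSpace_zero hx)) y
      (D.rootSpace_zero_le_H hsplit (D.IH_le_rootSpace_zero hy))]
    exact zero_mem _
  · exact D.map₂_Iclass_le D.mu (fun β γ x hx y hy => D.mu_mem_rootSpace hx hy)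
      (fun β hβ x hx y hy => D.mu_mem_IH hβ hx hy)
      fun x hx y hy => D.mu_IH_rootSpace_zero_mem hx (D.IH_le_rootSpace_zero hy)

end BHPS
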